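/- arXiv:1902.08145 — 2 statements merged into one kernel-verified Lean document; each statement's English description precedes it below -/
import Mathlib

section
/- Let H be a real Hilbert space, let F, G : H → [0,∞] be proper, lower semicontinuous, convex functionals, and let δ ≥ 0 be such that F(u) − δ ≤ G(u) ≤ F(u) + δ for all u ∈ H. Let τ > 0 and u₀, v₀ ∈ H. Then ‖J_τ^F[u₀] − J_τ^G[v₀]‖ ≤ ‖u₀ − v₀‖ + 2√(δτ). -/
open scoped ENNReal

/-- Convexity of a `[0,∞]`-valued functional, with the conventions of
extended arithmetic (in particular `0 * ∞ = 0`). -/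
def EConvexOn {H : Type*} [AddCommGroup H] [Module ℝ H] (F : H → ℝ≥0∞) : Prop :=
  ∀ u v : H, ∀ a b : ℝ, 0 ≤ a → 0 ≤ b → a + b = 1 →
    F (a • u + b • v) ≤ ENNReal.ofReal a * F u + ENNReal.ofReal b * F v

/-- `m` is the proximal point `J_τ^F[u₀]`, i.e. a minimizer of
`u ↦ (1/(2τ))‖u − u₀‖² + F(u)`. -/
def IsProx {H : Type*} [NormedAddCommGroup H] (F : H → ℝ≥0∞) (τ : ℝ) (u₀ m : H) : Prop :=
  ∀ u : H,
    ENNReal.ofReal ((1 / (2 * τ)) * ‖m - u₀‖ ^ 2) + F m ≤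
      ENNReal.ofReal ((1 / (2 * τ)) * ‖u - u₀‖ ^ 2) + F u

theorem IsProx.ne_top {H : Type*} [NormedAddCommGroup H] {F : H → ℝ≥0∞} {τ : ℝ} {u₀ p : H}
    (hp : IsProx F τ u₀ p) (hF : ∃ u, F u ≠ ∞) : F p ≠ ∞ := by
  obtain ⟨w, hw⟩ := hF
  have hlt := (hp w).trans_lt (ENNReal.add_lt_top.2 ⟨ENNReal.ofReal_lt_top, hw.lt_top⟩)
  exact (ENNReal.add_lt_top.1 hlt).2.ne

/-- The variational inequality satisfied by a proximal point of a convex functional. -/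
theorem IsProx.mul_sub_le_inner {H : Type*} [NormedAddCommGroup H] [InnerProductSpace ℝ H]
    {F : H → ℝ≥0∞} {τ : ℝ} {u₀ p q : H} (hp : IsProx F τ u₀ p) (hF : EConvexOn F)
    (hτ : 0 < τ) (hFp : F p ≠ ∞) (hFq : F q ≠ ∞) :
    τ * ((F p).toReal - (F q).toReal) ≤ inner ℝ (p - u₀) (q - p) := by
  have key : ∀ t : ℝ, 0 < t → t < 1 →
      2 * (τ * ((F p).toReal - (F q).toReal)) ≤
        2 * inner ℝ (p - u₀) (q - p) + t * ‖q - p‖ ^ 2 := by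
    intro t ht ht1
    have h := (hp ((1 - t) • p + t • q)).trans
      (add_le_add_right (hF p q (1 - t) t (by linarith) ht.le (by ring)) _)
    have hnorm : ‖(1 - t) • p + t • q - u₀‖ ^ 2 =
        ‖p - u₀‖ ^ 2 + 2 * (t * inner ℝ (p - u₀) (q - p)) + t ^ 2 * ‖q - p‖ ^ 2 := by
      rw [show (1 - t) • p + t • q - u₀ = (p - u₀) + t • (q - p) by module,
        norm_add_sq_real, inner_smul_right, norm_smul, mul_pow, Real.norm_eq_abs, sq_abs]
    lift F p to NNReal using hFp with a
    lift F q to NNReal using hFq with b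
    have h1 : 0 ≤ 1 - t := by linarith
    rw [← ENNReal.ofReal_coe_nnreal (p := a), ← ENNReal.ofReal_coe_nnreal (p := b),
      ← ENNReal.ofReal_mul h1, ← ENNReal.ofReal_mul ht.le,
      ← ENNReal.ofReal_add (by positivity) (by positivity),
      ← ENNReal.ofReal_add (by positivity) (by positivity),
      ← ENNReal.ofReal_add (by positivity) (by positivity),
      ENNReal.ofReal_le_ofReal_iff (by positivity), hnorm] at h
    simp only [ENNReal.coe_toReal]
    have h2 := mul_le_mul_of_nonneg_left h (by positivity : 0 ≤ 2 * τ)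
    have h3 : ∀ x y : ℝ, 2 * τ * (1 / (2 * τ) * x + y) = x + 2 * τ * y := by
      intro x y
      field_simp
    rw [h3, h3] at h2
    refine le_of_mul_le_mul_left ?_ ht
    linarith
  have hlim : Filter.Tendsto
      (fun t : ℝ => 2 * inner ℝ (p - u₀) (q - p) + t * ‖q - p‖ ^ 2)
      (nhdsWithin 0 (Set.Ioi 0)) (nhds (2 * inner ℝ (p - u₀) (q - p) + 0 * ‖q - p‖ ^ 2)) :=
    ((by fun_prop : Continuous
      (fun t : ℝ => 2 * inner ℝ (p - u₀) (q - p) + t * ‖q - p‖ ^ 2)).tendsto 0).mono_left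
      nhdsWithin_le_nhds
  have hle := ge_of_tendsto hlim (by
    filter_upwards [Ioo_mem_nhdsGT (zero_lt_one' ℝ)] with t ht
    exact key t ht.1 ht.2)
  linarith

/-- If `F(u) − δ ≤ G(u) ≤ F(u) + δ` for all `u` (in the extended reals), then
`‖J_τ^F[u₀] − J_τ^G[v₀]‖ ≤ ‖u₀ − v₀‖ + 2√(δτ)`. -/
theorem prox_one_step_comparison {H : Type*} [NormedAddCommGroup H] [InnerProductSpace ℝ H]
    [CompleteSpace H]
    (F G : H → ℝ≥0∞) (hFproper : ∃ u, F u ≠ ∞) (hGproper : ∃ u, G u ≠ ∞)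
    (hFlsc : LowerSemicontinuous F) (hGlsc : LowerSemicontinuous G)
    (hFconv : EConvexOn F) (hGconv : EConvexOn G)
    (δ : ℝ) (hδ : 0 ≤ δ)
    (hFG : ∀ u : H, F u ≤ G u + ENNReal.ofReal δ ∧ G u ≤ F u + ENNReal.ofReal δ)
    (τ : ℝ) (hτ : 0 < τ) (u₀ v₀ : H) (u₁F v₁G : H)
    (hu₁F : IsProx F τ u₀ u₁F) (hv₁G : IsProx G τ v₀ v₁G) :
    ‖u₁F - v₁G‖ ≤ ‖u₀ - v₀‖ + 2 * Real.sqrt (δ * τ) := by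
  have hFp := hu₁F.ne_top hFproper
  have hGq := hv₁G.ne_top hGproper
  have hFq : F v₁G ≠ ∞ :=
    ne_top_of_le_ne_top (ENNReal.add_ne_top.2 ⟨hGq, ENNReal.ofReal_ne_top⟩) (hFG v₁G).1
  have hGp : G u₁F ≠ ∞ :=
    ne_top_of_le_ne_top (ENNReal.add_ne_top.2 ⟨hFp, ENNReal.ofReal_ne_top⟩) (hFG u₁F).2
  have hF := hu₁F.mul_sub_le_inner hFconv hτ hFp hFq
  have hG := hv₁G.mul_sub_le_inner hGconv hτ hGq hGp
  have hp : (G u₁F).toReal ≤ (F u₁F).toReal + δ := by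
    have h := ENNReal.toReal_mono (ENNReal.add_ne_top.2 ⟨hFp, ENNReal.ofReal_ne_top⟩) (hFG u₁F).2
    rwa [ENNReal.toReal_add hFp ENNReal.ofReal_ne_top, ENNReal.toReal_ofReal hδ] at h
  have hq : (F v₁G).toReal ≤ (G v₁G).toReal + δ := by
    have h := ENNReal.toReal_mono (ENNReal.add_ne_top.2 ⟨hGq, ENNReal.ofReal_ne_top⟩) (hFG v₁G).1
    rwa [ENNReal.toReal_add hGq ENNReal.ofReal_ne_top, ENNReal.toReal_ofReal hδ] at h
  have hsum : inner ℝ (u₁F - u₀) (v₁G - u₁F) + inner ℝ (v₁G - v₀) (u₁F - v₁G) =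
      inner ℝ (u₀ - v₀) (u₁F - v₁G) - ‖u₁F - v₁G‖ ^ 2 := by
    rw [← real_inner_self_eq_norm_sq, ← neg_sub u₁F v₁G, inner_neg_right, ← inner_neg_left,
      ← inner_add_left, ← inner_sub_left]
    congr 1
    abel
  have hcs := real_inner_le_norm (u₀ - v₀) (u₁F - v₁G)
  have hmul := mul_le_mul_of_nonneg_left (add_le_add hp hq) hτ.le
  have hsq : Real.sqrt (δ * τ) ^ 2 = δ * τ := Real.sq_sqrt (by positivity)
  have hquad : ‖u₁F - v₁G‖ ^ 2 ≤
      ‖u₀ - v₀‖ * ‖u₁F - v₁G‖ + 2 * Real.sqrt (δ * τ) ^ 2 := by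
    linarith
  have hs := Real.sqrt_nonneg (δ * τ)
  have he := norm_nonneg (u₀ - v₀)
  by_contra! hlt
  nlinarith [mul_nonneg he hs]
end

section
/- Let H be a real Hilbert space, let F, G : H → [0,∞] be proper, lower semicontinuous, convex functionals, and let δ ≥ 0 be such that F(u) − δ ≤ G(u) ≤ F(u) + δ for all u ∈ H. Let L > 0, u₀, v₀ ∈ H, and let u, v : [0,∞) → H be curves with u(0) = u₀, v(0) = v₀ satisfying, for every t > 0 and every positive integer n, the a priori minimizing-movement estimates ‖u(t) − (J_{t/n}^F)ⁿ[u₀]‖ ≤ L t /(√2 · n) and ‖v(t) − (J_{t/n}^G)ⁿ[v₀]‖ ≤ L t /(√2 · n). Then for all t ≥ 0: if 0 ≤ t ≤ δ/L² then ‖u(t) − v(t)‖ ≤ 4√(δ t) + ‖u₀ − v₀‖, and if t > δ/L² then ‖u(t) − v(t)‖ ≤ 8 (L δ t²)^{1/3} + ‖u₀ − v₀‖. -/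
open scoped ENNReal

open Filter Topology

section Prox

variable {H : Type*} [NormedAddCommGroup H]

theorem IsProx.ne_top_s8 {F : H → ℝ≥0∞} {τ : ℝ} {w m : H} (h : IsProx F τ w m)
    (hF : ∃ u, F u ≠ ∞) : F m ≠ ∞ := by
  obtain ⟨u, hu⟩ := hF
  exact ne_top_of_le_ne_top (ENNReal.add_ne_top.2 ⟨ENNReal.ofReal_ne_top, hu⟩)
    (le_add_self.trans (h u))

theorem IsProx.toReal_le {F : H → ℝ≥0∞} {τ : ℝ} (hτ : 0 < τ) {w m : H} (h : IsProx F τ w m)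
    {x : H} {r : ℝ} (hr : 0 ≤ r) (hx : F x ≤ ENNReal.ofReal r) :
    1 / (2 * τ) * ‖m - w‖ ^ 2 + (F m).toReal ≤ 1 / (2 * τ) * ‖x - w‖ ^ 2 + r := by
  have hm : F m ≠ ∞ := h.ne_top_s8 ⟨x, ne_top_of_le_ne_top ENNReal.ofReal_ne_top hx⟩
  have key := (h x).trans (add_le_add le_rfl hx)
  rw [← ENNReal.ofReal_toReal hm, ← ENNReal.ofReal_add (by positivity) (by positivity),
    ← ENNReal.ofReal_add (by positivity) hr, ENNReal.ofReal_le_ofReal_iff (by positivity)] at key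
  exact key

theorem norm_iterate_sub_iterate_sq_le {f g : H → H} {c : ℝ}
    (h : ∀ x y, ‖f x - g y‖ ^ 2 ≤ ‖x - y‖ ^ 2 + c) (x y : H) (n : ℕ) :
    ‖f^[n] x - g^[n] y‖ ^ 2 ≤ ‖x - y‖ ^ 2 + n * c := by
  induction n with
  | zero => simp
  | succ n ih =>
    rw [Function.iterate_succ_apply', Function.iterate_succ_apply']
    push_cast
    linarith [h (f^[n] x) (g^[n] y)]

variable [InnerProductSpace ℝ H]

theorem norm_convex_combination_sub_sq (a x w : H) (s : ℝ) :
    ‖((1 - s) • a + s • x) - w‖ ^ 2 =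
      (1 - s) * ‖a - w‖ ^ 2 + s * ‖x - w‖ ^ 2 - s * (1 - s) * ‖x - a‖ ^ 2 := by
  have h1 : ((1 - s) • a + s • x) - w = (1 - s) • (a - w) + s • (x - w) := by module
  have h2 : x - a = (x - w) - (a - w) := by abel
  rw [h1, h2, norm_add_sq_real, norm_sub_sq_real (x - w), norm_smul, norm_smul, mul_pow, mul_pow,
    Real.norm_eq_abs, Real.norm_eq_abs, sq_abs, sq_abs, inner_smul_left, inner_smul_right,
    real_inner_comm (x - w)]
  simp only [conj_trivial]
  ring

/-- The evolution variational inequality satisfied by proximal points. -/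
theorem IsProx.variational_inequality {F : H → ℝ≥0∞} (hF : EConvexOn F) {τ : ℝ} (hτ : 0 < τ)
    {w m x : H} (h : IsProx F τ w m) (hx : F x ≠ ∞) :
    ‖m - w‖ ^ 2 + ‖x - m‖ ^ 2 + 2 * τ * (F m).toReal ≤
      ‖x - w‖ ^ 2 + 2 * τ * (F x).toReal := by
  have hm : F m ≠ ∞ := h.ne_top_s8 ⟨x, hx⟩
  have key : ∀ s ∈ Set.Ioo (0 : ℝ) 1,
      ‖m - w‖ ^ 2 + (1 - s) * ‖x - m‖ ^ 2 + 2 * τ * (F m).toReal ≤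
        ‖x - w‖ ^ 2 + 2 * τ * (F x).toReal := by
    rintro s ⟨hs0, hs1⟩
    have hs1' : 0 ≤ 1 - s := by linarith
    have hc : F ((1 - s) • m + s • x) ≤
        ENNReal.ofReal ((1 - s) * (F m).toReal + s * (F x).toReal) := by
      refine (hF m x (1 - s) s hs1' hs0.le (by ring)).trans_eq ?_
      rw [ENNReal.ofReal_add (by positivity) (by positivity), ENNReal.ofReal_mul hs1',
        ENNReal.ofReal_mul hs0.le, ENNReal.ofReal_toReal hm, ENNReal.ofReal_toReal hx]
    have hle := h.toReal_le hτ (by positivity) hc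
    rw [norm_convex_combination_sub_sq] at hle
    have hle' := mul_le_mul_of_nonneg_left hle (by positivity : 0 ≤ 2 * τ)
    have hcancel : ∀ y z : ℝ, 2 * τ * (1 / (2 * τ) * y + z) = y + 2 * τ * z := by
      intro y z
      field_simp
    rw [hcancel, hcancel] at hle'
    refine le_of_mul_le_mul_left ?_ hs0
    linarith
  have hlim : Tendsto
      (fun s : ℝ => ‖m - w‖ ^ 2 + (1 - s) * ‖x - m‖ ^ 2 + 2 * τ * (F m).toReal) (𝓝[>] 0)
      (𝓝 (‖m - w‖ ^ 2 + ‖x - m‖ ^ 2 + 2 * τ * (F m).toReal)) := by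
    refine tendsto_nhdsWithin_of_tendsto_nhds (Continuous.tendsto' (by fun_prop) _ _ (by simp))
  exact le_of_tendsto hlim (eventually_of_mem (Ioo_mem_nhdsGT one_pos) key)

/-- A single proximal step for two functionals at distance at most `δ` increases the squared
distance by at most `4δτ`. -/
theorem IsProx.norm_sub_sq_le {F G : H → ℝ≥0∞} (hFproper : ∃ u, F u ≠ ∞)
    (hF : EConvexOn F) (hG : EConvexOn G) {δ : ℝ} (hδ : 0 ≤ δ)
    (hFG : ∀ u : H, F u ≤ G u + ENNReal.ofReal δ ∧ G u ≤ F u + ENNReal.ofReal δ)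
    {τ : ℝ} (hτ : 0 < τ) {x y a b : H} (ha : IsProx F τ x a) (hb : IsProx G τ y b) :
    ‖a - b‖ ^ 2 ≤ ‖x - y‖ ^ 2 + 4 * δ * τ := by
  have hFa : F a ≠ ∞ := ha.ne_top_s8 hFproper
  have hGa : G a ≠ ∞ := ne_top_of_le_ne_top (by finiteness) (hFG a).2
  have hGb : G b ≠ ∞ := hb.ne_top_s8 ⟨a, hGa⟩
  have hFb : F b ≠ ∞ := ne_top_of_le_ne_top (by finiteness) (hFG b).1
  have hb_le : (F b).toReal ≤ (G b).toReal + δ := by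
    simpa [ENNReal.toReal_add hGb, ENNReal.toReal_ofReal hδ] using
      ENNReal.toReal_mono (by finiteness) (hFG b).1
  have ha_le : (G a).toReal ≤ (F a).toReal + δ := by
    simpa [ENNReal.toReal_add hFa, ENNReal.toReal_ofReal hδ] using
      ENNReal.toReal_mono (by finiteness) (hFG a).2
  have h1 := ha.variational_inequality hF hτ hFb
  have h2 := hb.variational_inequality hG hτ hGa
  have h3 := mul_le_mul_of_nonneg_left (add_le_add hb_le ha_le) (by positivity : 0 ≤ 2 * τ)
  have hquad : ‖b - x‖ ^ 2 + ‖a - y‖ ^ 2 - ‖a - x‖ ^ 2 - ‖b - y‖ ^ 2 ≤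
      ‖a - b‖ ^ 2 + ‖x - y‖ ^ 2 := by
    have hnn := sq_nonneg ‖(a - b) - (x - y)‖
    simp only [norm_sub_sq_real, inner_sub_left, inner_sub_right] at hnn ⊢
    linarith [real_inner_comm a b, real_inner_comm a x, real_inner_comm a y,
      real_inner_comm b x, real_inner_comm b y, real_inner_comm x y]
  rw [norm_sub_rev b a] at h1
  linarith

end Prox

theorem sqrt_mul_le_rpow_one_third {δ L t : ℝ} (hδ : 0 ≤ δ) (hL : 0 < L) (ht : 0 ≤ t)
    (h : δ ≤ L ^ 2 * t) : √(δ * t) ≤ (L * δ * t ^ 2) ^ ((1 : ℝ) / 3) := by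
  have hA : 0 ≤ L * δ * t ^ 2 := by positivity
  refine le_of_pow_le_pow_left₀ (n := 6) (by norm_num) (by positivity) ?_
  have hl : √(δ * t) ^ 6 = (δ * t) ^ 3 := by
    rw [show 6 = 2 * 3 from rfl, pow_mul, Real.sq_sqrt (by positivity)]
  have hr : ((L * δ * t ^ 2) ^ ((1 : ℝ) / 3)) ^ 6 = (L * δ * t ^ 2) ^ 2 := by
    rw [← Real.rpow_natCast, ← Real.rpow_mul hA, ← Real.rpow_natCast]
    norm_num
  rw [hl, hr]
  calc (δ * t) ^ 3 = δ ^ 2 * t ^ 3 * δ := by ring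
    _ ≤ δ ^ 2 * t ^ 3 * (L ^ 2 * t) := by gcongr
    _ = (L * δ * t ^ 2) ^ 2 := by ring

/-- Two curves approximated uniformly (with the a priori minimizing-movement estimates)
by the proximal iterates of two proper, lower semicontinuous, convex functionals
at distance at most `δ` from each other satisfy
`‖u(t) − v(t)‖ ≤ 4√(δt) + ‖u₀ − v₀‖` for `0 ≤ t ≤ δ/L²` and
`‖u(t) − v(t)‖ ≤ 8(Lδt²)^{1/3} + ‖u₀ − v₀‖` for `t > δ/L²`. -/
theorem gradient_flow_comparison {H : Type*} [NormedAddCommGroup H] [InnerProductSpace ℝ H]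
    [CompleteSpace H]
    (F G : H → ℝ≥0∞) (hFproper : ∃ u, F u ≠ ∞) (hGproper : ∃ u, G u ≠ ∞)
    (hFlsc : LowerSemicontinuous F) (hGlsc : LowerSemicontinuous G)
    (hFconv : EConvexOn F) (hGconv : EConvexOn G)
    (δ : ℝ) (hδ : 0 ≤ δ)
    (hFG : ∀ u : H, F u ≤ G u + ENNReal.ofReal δ ∧ G u ≤ F u + ENNReal.ofReal δ)
    (L : ℝ) (hL : 0 < L) (u₀ v₀ : H)
    (JF JG : ℝ → H → H)
    (hJF : ∀ τ : ℝ, 0 < τ → ∀ w : H, IsProx F τ w (JF τ w))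
    (hJG : ∀ τ : ℝ, 0 < τ → ∀ w : H, IsProx G τ w (JG τ w))
    (u v : ℝ → H) (hu0 : u 0 = u₀) (hv0 : v 0 = v₀)
    (hapu : ∀ t : ℝ, 0 < t → ∀ n : ℕ, 0 < n →
      ‖u t - (JF (t / n))^[n] u₀‖ ≤ L * t / (Real.sqrt 2 * n))
    (hapv : ∀ t : ℝ, 0 < t → ∀ n : ℕ, 0 < n →
      ‖v t - (JG (t / n))^[n] v₀‖ ≤ L * t / (Real.sqrt 2 * n)) :
    ∀ t : ℝ, 0 ≤ t →
      (t ≤ δ / L ^ 2 → ‖u t - v t‖ ≤ 4 * Real.sqrt (δ * t) + ‖u₀ - v₀‖) ∧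
      (δ / L ^ 2 < t → ‖u t - v t‖ ≤ 8 * (L * δ * t ^ 2) ^ ((1 : ℝ) / 3) + ‖u₀ - v₀‖) := by
  intro t ht
  have hmain : ‖u t - v t‖ ≤ 2 * √(δ * t) + ‖u₀ - v₀‖ := by
    rcases ht.eq_or_lt with rfl | htpos
    · simp [hu0, hv0]
    have hn : ∀ n : ℕ, 0 < n →
        ‖u t - v t‖ ≤ 2 * √(δ * t) + ‖u₀ - v₀‖ + 2 * (L * t / √2) / n := by
      intro n hn
      have hn' : (0 : ℝ) < n := Nat.cast_pos.2 hn
      have hτ : 0 < t / n := by positivity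
      have hiter := norm_iterate_sub_iterate_sq_le
        (fun x y => (hJF _ hτ x).norm_sub_sq_le hFproper hFconv hGconv hδ hFG hτ (hJG _ hτ y))
        u₀ v₀ n
      have hdist : ‖(JF (t / n))^[n] u₀ - (JG (t / n))^[n] v₀‖ ≤ 2 * √(δ * t) + ‖u₀ - v₀‖ := by
        refine le_of_sq_le_sq (hiter.trans ?_) (by positivity)
        have hcancel : (n : ℝ) * (4 * δ * (t / n)) = 4 * (δ * t) := by field_simp
        rw [hcancel, add_sq, mul_pow, Real.sq_sqrt (by positivity)]
        have : 0 ≤ 2 * (2 * √(δ * t)) * ‖u₀ - v₀‖ := by positivity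
        linarith
      have hU := hapu t htpos n hn
      have hV := hapv t htpos n hn
      rw [norm_sub_rev] at hV
      rw [← div_div] at hU hV
      have h1 := norm_sub_le_norm_sub_add_norm_sub (u t) ((JF (t / n))^[n] u₀) (v t)
      have h2 := norm_sub_le_norm_sub_add_norm_sub ((JF (t / n))^[n] u₀)
        ((JG (t / n))^[n] v₀) (v t)
      rw [mul_div_assoc]
      linarith
    have hlim := (tendsto_const_div_atTop_nhds_zero_nat (2 * (L * t / √2))).const_add
      (2 * √(δ * t) + ‖u₀ - v₀‖)
    rw [add_zero] at hlim
    exact ge_of_tendsto hlim ((eventually_gt_atTop 0).mono hn)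
  refine ⟨fun _ => ?_, fun hlt => ?_⟩
  · linarith [Real.sqrt_nonneg (δ * t)]
  · rw [div_lt_iff₀ (by positivity), mul_comm] at hlt
    have := sqrt_mul_le_rpow_one_third hδ hL ht hlt.le
    linarith [Real.sqrt_nonneg (δ * t)]
end
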